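/- arXiv:1512.04137 — 5 statements merged into one kernel-verified Lean document; each statement's English description precedes it below -/
import Mathlib

section
/- Let f : (-∞, 0) → ℝ be a continuous and strictly increasing real-valued function such that the function x ↦ f(x)·sin(x) is integrable on (-∞, 0). Then ∫_{-∞}^{0} f(x)·sin(x) dx < 0. -/
open MeasureTheory Set

/-- If `f` is strictly increasing to the left of `0`, then the integral of `f * sin` over a period
of `sin` contained in `(-∞, 0]`, starting at a multiple of `2π`, is negative. -/
theorem intervalIntegral_strictMonoOn_mul_sin_neg {f : ℝ → ℝ} (hmono : StrictMonoOn f (Iio 0))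
    (hint : ∀ a b : ℝ, a ≤ 0 → b ≤ 0 →
      IntervalIntegrable (fun x => f x * Real.sin x) volume a b) (n : ℕ) :
    ∫ x in (-((n + 1 : ℕ) * (2 * Real.pi)))..(-(n * (2 * Real.pi))), f x * Real.sin x < 0 := by
  have hpi := Real.pi_pos
  have hn : 0 ≤ (n : ℝ) * (2 * Real.pi) := by positivity
  obtain ⟨m, hm⟩ : ∃ m : ℝ, m = -(n * (2 * Real.pi)) - Real.pi := ⟨_, rfl⟩
  have hl : -((n + 1 : ℕ) * (2 * Real.pi)) = m - Real.pi := by push_cast; linarith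
  have hr : -(n * (2 * Real.pi)) = m + Real.pi := by linarith
  have hm0 : m + Real.pi ≤ 0 := by linarith
  rw [hl, hr]
  have hsin : ∀ x, Real.sin x = -Real.sin (x - m) := by
    intro x
    have h : x - m = x + Real.pi + n * (2 * Real.pi) := by linarith
    rw [h, Real.sin_add_nat_mul_two_pi, Real.sin_add_pi, neg_neg]
  have hi : ∀ a b : ℝ, a ≤ 0 → b ≤ 0 →
      IntervalIntegrable (fun x => f m * Real.sin x - f x * Real.sin x) volume a b :=
    fun a b ha hb =>
      ((Real.continuous_sin.intervalIntegrable a b).const_mul (f m)).sub (hint a b ha hb)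
  have hleft : 0 < ∫ x in (m - Real.pi)..m, (f m * Real.sin x - f x * Real.sin x) := by
    refine intervalIntegral.intervalIntegral_pos_of_pos_on
      (hi _ _ (by linarith) (by linarith)) (fun x hx => ?_) (by linarith)
    have hs : Real.sin (x - m) < 0 :=
      Real.sin_neg_of_neg_of_neg_pi_lt (by linarith [hx.2]) (by linarith [hx.1])
    have hf : f x < f m :=
      hmono (mem_Iio.2 (by linarith [hx.2])) (mem_Iio.2 (by linarith)) hx.2
    rw [hsin x]
    nlinarith
  have hright : 0 < ∫ x in m..(m + Real.pi), (f m * Real.sin x - f x * Real.sin x) := by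
    refine intervalIntegral.intervalIntegral_pos_of_pos_on
      (hi _ _ (by linarith) (by linarith)) (fun x hx => ?_) (by linarith)
    have hs : 0 < Real.sin (x - m) :=
      Real.sin_pos_of_pos_of_lt_pi (by linarith [hx.1]) (by linarith [hx.2])
    have hf : f m < f x :=
      hmono (mem_Iio.2 (by linarith)) (mem_Iio.2 (by linarith [hx.2])) hx.1
    rw [hsin x]
    nlinarith
  have hadd := intervalIntegral.integral_add_adjacent_intervals
    (hi (m - Real.pi) m (by linarith) (by linarith))
    (hi m (m + Real.pi) (by linarith) (by linarith))
  have hsub := intervalIntegral.integral_sub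
    ((Real.continuous_sin.intervalIntegrable (m - Real.pi) (m + Real.pi)).const_mul (f m))
    (hint _ _ (by linarith) (by linarith))
  rw [intervalIntegral.integral_const_mul, integral_sin, Real.cos_sub_pi, Real.cos_add_pi,
    sub_self, mul_zero, zero_sub] at hsub
  linarith

/-- Let `f : (-∞, 0) → ℝ` be continuous and strictly increasing such that
`x ↦ f x * sin x` is Lebesgue integrable on `(-∞, 0)`.
Then `∫_{-∞}^{0} f x * sin x dx < 0`. -/
theorem integral_strictMono_mul_sin_neg (f : ℝ → ℝ)
    (hcont : ContinuousOn f (Iio 0))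
    (hmono : StrictMonoOn f (Iio 0))
    (hint : IntegrableOn (fun x => f x * Real.sin x) (Iio 0)) :
    ∫ x in Iio (0 : ℝ), f x * Real.sin x < 0 := by
  have hpi := Real.pi_pos
  have hint' : IntegrableOn (fun x => f x * Real.sin x) (Iic 0) :=
    integrableOn_Iic_iff_integrableOn_Iio (by finiteness) |>.2 hint
  have hi : ∀ a b : ℝ, a ≤ 0 → b ≤ 0 →
      IntervalIntegrable (fun x => f x * Real.sin x) volume a b := fun a b ha hb =>
    (hint'.mono_set fun x hx => hx.2.trans (max_le ha hb)).intervalIntegrable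
  have hneg := intervalIntegral_strictMonoOn_mul_sin_neg hmono hi
  have hanti : Antitone fun n : ℕ =>
      ∫ x in (-(n * (2 * Real.pi)))..0, f x * Real.sin x := by
    refine antitone_nat_of_succ_le fun n => ?_
    have hle : ∀ k : ℕ, -((k : ℝ) * (2 * Real.pi)) ≤ 0 := fun k =>
      neg_nonpos.2 (by positivity)
    have h := intervalIntegral.integral_add_adjacent_intervals
      (hi _ _ (hle (n + 1)) (hle n)) (hi _ 0 (hle n) le_rfl)
    linarith [hneg n]
  have hlim : Filter.Tendsto (fun n : ℕ => -((n : ℝ) * (2 * Real.pi)))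
      Filter.atTop Filter.atBot :=
    Filter.tendsto_neg_atTop_atBot.comp
      (tendsto_natCast_atTop_atTop.atTop_mul_const (by positivity))
  rw [← integral_Iic_eq_integral_Iio]
  refine (hanti.le_of_tendsto (intervalIntegral_tendsto_integral_Iic 0 hint' hlim) 1).trans_lt ?_
  simpa using hneg 0
end

section
/- For every nonzero real number t, the real part of Γ(it)/Γ(3/2 + it) is strictly negative, where Γ denotes the complex Gamma function and i is the imaginary unit. -/
open Complex

theorem multichoose_pos {a : ℝ} (ha : 0 < a) (n : ℕ) : 0 < Ring.multichoose a n := by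
  have h := Ring.factorial_nsmul_multichoose_eq_ascPochhammer a n
  rw [Polynomial.ascPochhammer_smeval_eq_eval, nsmul_eq_mul] at h
  exact pos_of_mul_pos_right (h ▸ ascPochhammer_pos n a ha) (by positivity)

open MeasureTheory in
/-- Integrating the binomial series of `(1 - x) ^ (-a)` term by term in the Beta integral. -/
theorem hasSum_betaIntegral_one_sub {u : ℂ} (hu : 0 < u.re) {a : ℝ} (ha₀ : 0 < a) (ha₁ : a < 1) :
    HasSum (fun n : ℕ => ((Ring.multichoose a n : ℝ) : ℂ) / (u + n)) (betaIntegral u (1 - a)) := by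
  have hasSum_binomial {x : ℝ} (hx₀ : 0 < x) (hx₁ : x < 1) :
      HasSum (fun n : ℕ => Ring.multichoose a n * x ^ n) ((1 - x) ^ (-a)) := by
    have h := (Real.one_div_one_sub_rpow_hasFPowerSeriesOnBall_zero a).hasSum (y := x)
      (by simpa [enorm_eq_nnnorm, ← NNReal.coe_lt_one, abs_of_pos hx₀] using hx₁)
    simp only [FormalMultilinearSeries.ofScalars_apply_eq, smul_eq_mul, zero_add, one_div,
      ← Ring.multichoose_eq] at h
    rwa [Real.rpow_neg (by linarith)]
  have ne_one : ∀ᵐ x : ℝ, x ≠ 1 := by simp [ae_iff]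
  have hsum := intervalIntegral.hasSum_integral_of_dominated_convergence (μ := volume)
    (a := (0 : ℝ)) (b := 1)
    (F := fun (n : ℕ) (x : ℝ) => (x : ℂ) ^ (u - 1) * ((Ring.multichoose a n * x ^ n : ℝ) : ℂ))
    (f := fun x : ℝ => (x : ℂ) ^ (u - 1) * (1 - (x : ℂ)) ^ ((1 - a : ℂ) - 1))
    (fun n x => x ^ (u.re - 1) * (Ring.multichoose a n * x ^ n))
    (fun n => by
      refine Measurable.aestronglyMeasurable ?_
      fun_prop)
    (fun n => ae_of_all _ fun x hx => by
      rw [Set.uIoc_of_le zero_le_one] at hx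
      rw [norm_mul, norm_cpow_eq_rpow_re_of_pos hx.1, norm_real, Real.norm_of_nonneg
        (mul_nonneg (multichoose_pos ha₀ n).le (pow_nonneg hx.1.le n))]
      simp)
    (by
      filter_upwards [ne_one] with x hx₁ hx
      rw [Set.uIoc_of_le zero_le_one] at hx
      exact (hasSum_binomial hx.1 (lt_of_le_of_ne hx.2 hx₁)).summable.mul_left _)
    (by
      refine (betaIntegral_convergent hu (v := 1 - a) (by simpa using ha₁)).norm.congr_ae ?_
      rw [Filter.EventuallyEq, ae_restrict_iff' measurableSet_uIoc]
      filter_upwards [ne_one] with x hx₁ hx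
      rw [Set.uIoc_of_le zero_le_one] at hx
      have hx₁ := lt_of_le_of_ne hx.2 hx₁
      rw [tsum_mul_left, (hasSum_binomial hx.1 hx₁).tsum_eq, norm_mul,
        norm_cpow_eq_rpow_re_of_pos hx.1, ← ofReal_one, ← ofReal_sub 1 x,
        norm_cpow_eq_rpow_re_of_pos (sub_pos.2 hx₁)]
      simp)
    (by
      filter_upwards [ne_one] with x hx₁ hx
      rw [Set.uIoc_of_le zero_le_one] at hx
      have hx₁ := lt_of_le_of_ne hx.2 hx₁
      refine HasSum.mul_left _ ?_
      have h := hasSum_ofReal.2 (hasSum_binomial hx.1 hx₁)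
      rw [ofReal_cpow (sub_pos.2 hx₁).le] at h
      simpa using h)
  refine hsum.congr_fun ?_
  intro n
  have hre : 0 < (u + n).re := by
    simp only [add_re, natCast_re]
    positivity
  have hne : u + n ≠ 0 := fun h => by simp [h] at hre
  have hint : ∫ x : ℝ in (0 : ℝ)..1, (x : ℂ) ^ (u + n - 1) = 1 / (u + n) := by
    rw [integral_cpow (Or.inl (by simpa using hre))]
    simp [hne]
  rw [div_eq_mul_one_div, ← hint, ← intervalIntegral.integral_const_mul]
  refine intervalIntegral.integral_congr_ae (ae_of_all _ fun x hx => ?_)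
  rw [Set.uIoc_of_le zero_le_one] at hx
  rw [add_sub_right_comm, cpow_add _ _ (ofReal_ne_zero.2 hx.1.ne'), cpow_natCast]
  push_cast
  ring

/-- For every nonzero real `t`, `Re (Γ(it) / Γ(3/2 + it)) < 0`. -/
theorem re_gamma_div_gamma_neg (t : ℝ) (ht : t ≠ 0) :
    (Complex.Gamma (Complex.I * t) / Complex.Gamma (3 / 2 + Complex.I * t)).re < 0 := by
  have hIt : I * t ≠ 0 := mul_ne_zero I_ne_zero (ofReal_ne_zero.2 ht)
  have ht' : (t : ℂ) ≠ 0 := ofReal_ne_zero.2 ht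
  have hre : 0 < (I * t + 1).re := by simp
  have hbeta := betaIntegral_eq_Gamma_mul_div (I * t + 1) (1 / 2) hre (by norm_num)
  have hsqrt : Gamma (1 / 2) = (√Real.pi : ℂ) := by
    rw [← Real.Gamma_one_half_eq, ← Gamma_ofReal]
    norm_num
  have hpi : 0 < √Real.pi := Real.sqrt_pos.2 Real.pi_pos
  have hpi' : (√Real.pi : ℂ) ≠ 0 := ofReal_ne_zero.2 hpi.ne'
  rw [Gamma_add_one _ hIt, hsqrt, show I * t + 1 + 1 / 2 = 3 / 2 + I * t by ring] at hbeta
  have hquot : Gamma (I * t) / Gamma (3 / 2 + I * t) =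
      betaIntegral (I * t + 1) (1 / 2) * (1 / (I * t)) * ((√Real.pi)⁻¹ : ℝ) := by
    rw [hbeta]
    rw [ofReal_inv]
    generalize Gamma (3 / 2 + I * t) = G
    field_simp
  have hsum := hasSum_betaIntegral_one_sub hre (a := 1 / 2) (by norm_num) (by norm_num)
  rw [show (1 - ((1 / 2 : ℝ) : ℂ)) = 1 / 2 by push_cast; norm_num] at hsum
  have hterm (n : ℕ) : (((Ring.multichoose (1 / 2 : ℝ) n : ℝ) : ℂ) / (I * t + 1 + n) *
      (1 / (I * t))).re = -(Ring.multichoose (1 / 2 : ℝ) n / ((n + 1) ^ 2 + t ^ 2)) := by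
    have hden : ((n : ℝ) + 1) ^ 2 + t ^ 2 ≠ 0 := by positivity
    have hsplit : ((Ring.multichoose (1 / 2 : ℝ) n : ℝ) : ℂ) / (I * t + 1 + n) * (1 / (I * t)) =
        ((-(Ring.multichoose (1 / 2 : ℝ) n / ((n + 1) ^ 2 + t ^ 2)) : ℝ) : ℂ) +
        ((-(Ring.multichoose (1 / 2 : ℝ) n * (n + 1) / (t * ((n + 1) ^ 2 + t ^ 2))) : ℝ) : ℂ) * I := by
      have hden' : ((n : ℂ) + 1) ^ 2 + t ^ 2 ≠ 0 := by exact_mod_cast hden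
      have hn : I * t + 1 + n ≠ 0 := fun h => by
        have := congrArg im h
        simp [ht] at this
      push_cast
      field_simp
      ring_nf
      simp only [I_sq, show I ^ 3 = -I by rw [pow_succ, I_sq]; ring]
      ring
    rw [hsplit, add_re, re_ofReal_mul, ofReal_re, I_re, mul_zero, add_zero]
  have hterm_neg (n : ℕ) : (((Ring.multichoose (1 / 2 : ℝ) n : ℝ) : ℂ) / (I * t + 1 + n) *
      (1 / (I * t))).re < 0 := by
    rw [hterm, neg_lt_zero]
    have := multichoose_pos one_half_pos n
    positivity
  rw [hquot, re_mul_ofReal]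
  exact mul_neg_of_neg_of_pos (hasSum_lt (fun n => (hterm_neg n).le) (hterm_neg 0)
    (hasSum_re (hsum.mul_right (1 / (I * t)))) hasSum_zero) (inv_pos.2 hpi)
end

section
/- For every real t > 0, one has (2t/3)·∫₀¹ cos(t·log s)·(1 − s)^{1/2} ds + ∫₀¹ sin(t·log s)·(1 − s)^{1/2} ds < 0. -/
open MeasureTheory Set

lemma continuous_mul_comp_log {f : ℝ → ℝ} {C : ℝ} (hf : Continuous f) (hC : ∀ x, |f x| ≤ C) :
    Continuous (fun s => s * f (Real.log s)) := by
  refine continuous_iff_continuousAt.2 fun s => ?_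
  rcases eq_or_ne s 0 with rfl | hs
  · have h : Filter.Tendsto (fun s : ℝ => |s| * C) (nhds 0) (nhds 0) := by
      have : ContinuousAt (fun s : ℝ => |s| * C) 0 := by fun_prop
      simpa [ContinuousAt] using this
    simp only [ContinuousAt, zero_mul]
    refine squeeze_zero_norm (fun s => ?_) h
    rw [Real.norm_eq_abs, abs_mul]
    exact mul_le_mul_of_nonneg_left (hC _) (abs_nonneg s)
  · exact continuousAt_id.mul (hf.continuousAt.comp (Real.continuousAt_log hs))

/-- Since `log` vanishes to first order at `1`, so does the quotient
`(1 - cos (t log s)) / √(1 - s)` from the left. -/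
lemma one_sub_cos_log_div_sqrt_le {t s : ℝ} (hs : 1 / 2 ≤ s) (hs1 : s ≤ 1) :
    (1 - Real.cos (t * Real.log s)) / √(1 - s) ≤ 2 * t ^ 2 * (1 - s) := by
  rcases hs1.eq_or_lt with rfl | h1
  · simp
  have hr : 0 < √(1 - s) := Real.sqrt_pos.2 (by linarith)
  have hr1 : √(1 - s) ≤ 1 := Real.sqrt_le_one.2 (by linarith)
  have hsq : √(1 - s) ^ 2 = 1 - s := Real.sq_sqrt (by linarith)
  have hlog : -(2 * (1 - s)) ≤ Real.log s := by
    refine le_trans ?_ (Real.one_sub_inv_le_log_of_pos (by linarith))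
    have : s⁻¹ ≤ 1 + 2 * (1 - s) := by
      rw [inv_le_iff_one_le_mul₀ (by linarith)]
      nlinarith
    linarith
  have hlog0 : Real.log s ≤ 0 := Real.log_nonpos (by linarith) hs1
  have hl2 : Real.log s ^ 2 ≤ 4 * (1 - s) ^ 2 := by nlinarith
  have hc := Real.one_sub_sq_div_two_le_cos (x := t * Real.log s)
  have hmain : 1 - Real.cos (t * Real.log s) ≤ 2 * t ^ 2 * (1 - s) ^ 2 := by
    nlinarith [mul_le_mul_of_nonneg_left hl2 (sq_nonneg t)]
  rw [div_le_iff₀ hr]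
  refine hmain.trans ?_
  have : 1 - s ≤ √(1 - s) := by nlinarith
  have h0 : 0 ≤ 2 * t ^ 2 * (1 - s) := by
    have : 0 ≤ 1 - s := by linarith
    positivity
  nlinarith [mul_le_mul_of_nonneg_left this h0]

/-- An antiderivative of an upper bound of the integrand, continuous up to both endpoints. -/
noncomputable def majorantPrimitive (t s : ℝ) : ℝ :=
  s * (2 / 3 * √(1 - s) * Real.sin (t * Real.log s) +
    1 / (3 * t) * ((1 - Real.cos (t * Real.log s)) / √(1 - s)) -
    1 / (3 * t) * (1 - (Real.cos (t * Real.log s) + t * Real.sin (t * Real.log s)) / (1 + t ^ 2)))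

lemma hasDerivAt_majorantPrimitive {t s : ℝ} (ht : 0 < t) (hs : s ∈ Ioo (0 : ℝ) 1) :
    HasDerivAt (majorantPrimitive t)
      (2 * t / 3 * (Real.cos (t * Real.log s) * √(1 - s)) + Real.sin (t * Real.log s) * √(1 - s) +
        1 / (3 * t) * (1 - Real.cos (t * Real.log s)) *
          (1 / √(1 - s) + s / (2 * √(1 - s) ^ 3) - 1)) s := by
  obtain ⟨h0, h1⟩ := hs
  have hr : 0 < √(1 - s) := Real.sqrt_pos.2 (by linarith)
  have hsq : √(1 - s) ^ 2 = 1 - s := Real.sq_sqrt (by linarith)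
  have dθ : HasDerivAt (fun s => t * Real.log s) (t * s⁻¹) s :=
    (Real.hasDerivAt_log h0.ne').const_mul t
  have dr : HasDerivAt (fun s => √(1 - s)) (-1 / (2 * √(1 - s))) s :=
    ((hasDerivAt_id s).const_sub 1).sqrt (by simp; linarith)
  have key := (hasDerivAt_id s).mul (((dr.const_mul (2 / 3)).mul dθ.sin).add
    (((dθ.cos.const_sub 1).div dr hr.ne').const_mul (1 / (3 * t))) |>.sub
    (((dθ.cos.add (dθ.sin.const_mul t)).div_const (1 + t ^ 2)).const_sub 1 |>.const_mul
      (1 / (3 * t))))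
  refine key.congr_deriv ?_
  simp only [id, Pi.mul_apply, Pi.add_apply, Pi.sub_apply, Pi.div_apply]
  generalize √(1 - s) = r at *
  obtain rfl : s = 1 - r ^ 2 := by linarith
  have ht2 : 1 + t ^ 2 ≠ 0 := by positivity
  have hr0 := hr.ne'
  have hs0 := h0.ne'
  field_simp
  ring

lemma continuousOn_majorantPrimitive (t : ℝ) :
    ContinuousOn (majorantPrimitive t) (Icc 0 1) := by
  have hsin : Continuous fun s => s * Real.sin (t * Real.log s) :=
    continuous_mul_comp_log (f := fun x => Real.sin (t * x)) (by fun_prop)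
      fun x => Real.abs_sin_le_one _
  have hcos : Continuous fun s => s * Real.cos (t * Real.log s) :=
    continuous_mul_comp_log (f := fun x => Real.cos (t * x)) (by fun_prop)
      fun x => Real.abs_cos_le_one _
  have hquot : ContinuousOn
      (fun s => (s - s * Real.cos (t * Real.log s)) / √(1 - s)) (Icc 0 1) := by
    intro s hs
    rcases hs.2.eq_or_lt with rfl | h1
    · have hlim : Filter.Tendsto (fun s : ℝ => 2 * t ^ 2 * (1 - s)) (nhdsWithin 1 (Icc 0 1))
          (nhds 0) := by
        have : ContinuousWithinAt (fun s : ℝ => 2 * t ^ 2 * (1 - s)) (Icc 0 1) 1 := by fun_prop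
        simpa [ContinuousWithinAt] using this
      have hnear : ∀ᶠ s : ℝ in nhdsWithin 1 (Icc 0 1), 1 / 2 ≤ s :=
        nhdsWithin_le_nhds (eventually_ge_nhds (by norm_num))
      simp only [ContinuousWithinAt, sub_self, Real.sqrt_zero, div_zero]
      refine squeeze_zero' ?_ ?_ hlim
      · filter_upwards [self_mem_nhdsWithin] with s hs
        refine div_nonneg ?_ (Real.sqrt_nonneg _)
        nlinarith [hs.1, Real.cos_le_one (t * Real.log s)]
      · filter_upwards [hnear, self_mem_nhdsWithin] with s hs hs'
        refine le_trans ?_ (one_sub_cos_log_div_sqrt_le hs hs'.2)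
        refine div_le_div_of_nonneg_right ?_ (Real.sqrt_nonneg _)
        nlinarith [hs'.2, Real.cos_le_one (t * Real.log s)]
    · refine ContinuousAt.continuousWithinAt (ContinuousAt.div (by fun_prop) (by fun_prop) ?_)
      exact (Real.sqrt_pos.2 (by linarith)).ne'
  have hrest : Continuous fun s => 2 / 3 * √(1 - s) * (s * Real.sin (t * Real.log s)) -
      1 / (3 * t) * (s - (s * Real.cos (t * Real.log s) +
        t * (s * Real.sin (t * Real.log s))) / (1 + t ^ 2)) := by
    fun_prop
  refine (hrest.continuousOn.add (hquot.const_mul (1 / (3 * t)))).congr fun s _ => ?_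
  simp only [majorantPrimitive, Pi.add_apply]
  ring

/-- For every real `t > 0`,
`(2t/3) ∫₀¹ cos(t log s) (1-s)^{1/2} ds + ∫₀¹ sin(t log s) (1-s)^{1/2} ds < 0`. -/
theorem cos_sin_sqrt_integral_neg (t : ℝ) (ht : 0 < t) :
    (2 * t / 3) * (∫ s in Ioo (0 : ℝ) 1, Real.cos (t * Real.log s) * (1 - s) ^ ((1 : ℝ) / 2)) +
      (∫ s in Ioo (0 : ℝ) 1, Real.sin (t * Real.log s) * (1 - s) ^ ((1 : ℝ) / 2)) < 0 := by
  simp only [← Real.sqrt_eq_rpow]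
  have integrable_mul_sqrt : ∀ f : ℝ → ℝ, Measurable f → (∀ s, |f s| ≤ 1) →
      IntegrableOn (fun s => f s * √(1 - s)) (Icc 0 1) := fun f hf hb => by
    refine Measure.integrableOn_of_bounded (M := 1) (by simp) (by fun_prop) ?_
    refine (ae_restrict_iff' measurableSet_Icc).2 (.of_forall fun s hs => ?_)
    rw [Real.norm_eq_abs, abs_mul, abs_of_nonneg (Real.sqrt_nonneg _)]
    exact mul_le_one₀ (hb s) (Real.sqrt_nonneg _) (Real.sqrt_le_one.2 (by linarith [hs.1]))
  have hc := integrable_mul_sqrt (fun s => Real.cos (t * Real.log s)) (by fun_prop)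
    fun s => Real.abs_cos_le_one _
  have hsin := integrable_mul_sqrt (fun s => Real.sin (t * Real.log s)) (by fun_prop)
    fun s => Real.abs_sin_le_one _
  have hle := intervalIntegral.integral_le_sub_of_hasDeriv_right_of_le zero_le_one
    (continuousOn_majorantPrimitive t)
    (fun s hs => (hasDerivAt_majorantPrimitive ht hs).hasDerivWithinAt)
    ((hc.const_mul (2 * t / 3)).add hsin) (fun s hs => by
      have hr : 0 < √(1 - s) := Real.sqrt_pos.2 (by linarith [hs.2])
      have hr1 : √(1 - s) ≤ 1 := Real.sqrt_le_one.2 (by linarith [hs.1])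
      have h1 : 1 ≤ 1 / √(1 - s) := (one_le_div hr).2 hr1
      have h2 : 0 ≤ s / (2 * √(1 - s) ^ 3) := div_nonneg hs.1.le (by positivity)
      refine le_add_of_nonneg_right (mul_nonneg (mul_nonneg (by positivity) ?_) (by linarith))
      linarith [Real.cos_le_one (t * Real.log s)])
  rw [intervalIntegral.integral_of_le zero_le_one, integral_Ioc_eq_integral_Ioo] at hle
  simp only [Pi.add_apply] at hle
  rw [integral_add ((hc.mono_set Ioo_subset_Icc_self).const_mul _)
    (hsin.mono_set Ioo_subset_Icc_self), integral_const_mul] at hle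
  refine hle.trans_lt ?_
  have : 1 / (1 + t ^ 2) < 1 := (div_lt_one (by positivity)).2 (by nlinarith)
  have h3 : 0 < 1 / (3 * t) * (1 - 1 / (1 + t ^ 2)) := mul_pos (by positivity) (by linarith)
  simp [majorantPrimitive] at h3 ⊢
  linarith
end

section
/- There exists a positive constant c > 0 such that for every real t with |t| > c, the real part of (Γ(it)/Γ(3/2 + it))·(it/(1 + it)) is strictly negative, where Γ denotes the complex Gamma function and i is the imaginary unit. -/
open Complex

/-- The Taylor coefficients of `(1 - x) ^ (-1 / 2)`. -/
noncomputable def invSqrtCoeff (n : ℕ) : ℝ := Ring.choose (1 / 2 + n - 1 : ℝ) n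

theorem invSqrtCoeff_eq (n : ℕ) :
    invSqrtCoeff n = (n.factorial : ℝ)⁻¹ * (ascPochhammer ℝ n).eval (1 / 2) := by
  have h := Ring.factorial_nsmul_multichoose_eq_ascPochhammer (1 / 2 : ℝ) n
  rw [Polynomial.ascPochhammer_smeval_eq_eval, nsmul_eq_mul] at h
  have h2 : invSqrtCoeff n = Ring.multichoose (1 / 2 : ℝ) n := by
    rw [invSqrtCoeff, Ring.choose]
    congr 1
    ring
  rw [h2, ← h, inv_mul_cancel_left₀ (by positivity)]

theorem invSqrtCoeff_nonneg (n : ℕ) : 0 ≤ invSqrtCoeff n := by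
  rw [invSqrtCoeff_eq]
  have := ascPochhammer_pos n (1 / 2 : ℝ) (by norm_num)
  positivity

theorem sum_range_four_invSqrtCoeff : ∑ n ∈ Finset.range 4, invSqrtCoeff n = 35 / 16 := by
  simp only [Finset.sum_range_succ, Finset.sum_range_zero, invSqrtCoeff_eq, ascPochhammer_succ_eval,
    ascPochhammer_zero, Polynomial.eval_one, Nat.factorial]
  norm_num

theorem hasSum_invSqrtCoeff {x : ℝ} (h0 : 0 ≤ x) (h1 : x < 1) :
    HasSum (fun n ↦ invSqrtCoeff n * x ^ n) (1 / (1 - x) ^ (1 / 2 : ℝ)) := by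
  have h := (Real.one_div_one_sub_rpow_hasFPowerSeriesOnBall_zero (1 / 2)).hasSum (y := x)
    (by simpa [Metric.mem_eball, abs_of_nonneg h0, ← ofReal_norm] using h1)
  simpa [mul_comm, FormalMultilinearSeries.ofScalars_apply_eq, invSqrtCoeff] using h

theorem one_div_one_sub_rpow_half {x : ℝ} (h1 : x < 1) :
    ((1 / (1 - x) ^ (1 / 2 : ℝ) : ℝ) : ℂ) = (1 - (x : ℂ)) ^ ((1 / 2 : ℂ) - 1) := by
  rw [one_div, ← Real.rpow_neg (by linarith), Complex.ofReal_cpow (by linarith)]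
  push_cast
  norm_num

theorem hasSum_betaIntegral_half (t : ℝ) :
    HasSum (fun n : ℕ ↦ (invSqrtCoeff n : ℂ) / (n + 1 + I * t))
      (betaIntegral (1 + I * t) (1 / 2)) := by
  have hterm (n : ℕ) : ∫ x in (0 : ℝ)..1, (invSqrtCoeff n : ℂ) * (x : ℂ) ^ ((n : ℂ) + I * t) =
      (invSqrtCoeff n : ℂ) / (n + 1 + I * t) := by
    have hn : (0 : ℝ) ≤ n := n.cast_nonneg
    have hne : (n : ℂ) + I * t + 1 ≠ 0 := fun h ↦ by
      have := congrArg re h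
      simp at this
      linarith
    rw [intervalIntegral.integral_const_mul, integral_cpow (Or.inl (by simp; linarith))]
    rw [ofReal_zero, zero_cpow hne]
    simp
    rw [div_eq_mul_inv]
    congr 2
    ring
  have hne1 : ∀ᵐ x : ℝ, x ≠ 1 := MeasureTheory.Measure.ae_ne _ _
  simp_rw [← hterm]
  rw [betaIntegral]
  refine intervalIntegral.hasSum_integral_of_dominated_convergence
    (fun n x ↦ invSqrtCoeff n * x ^ n) (fun n ↦ ?_) (fun n ↦ ?_) ?_ ?_ ?_
  · exact (by fun_prop : Measurable _).aestronglyMeasurable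
  · refine .of_forall fun x hx ↦ ?_
    rw [Set.uIoc_of_le zero_le_one] at hx
    rw [norm_mul, norm_cpow_eq_rpow_re_of_pos hx.1]
    simp [abs_of_nonneg (invSqrtCoeff_nonneg n)]
  · filter_upwards [hne1] with x hx1 hx
    rw [Set.uIoc_of_le zero_le_one] at hx
    exact (hasSum_invSqrtCoeff hx.1.le (lt_of_le_of_ne hx.2 hx1)).summable
  · have hb := (betaIntegral_convergent (u := 1) (v := 1 / 2) (by simp) (by norm_num)).norm
    refine hb.congr_ae ?_
    rw [Filter.EventuallyEq, MeasureTheory.ae_restrict_iff' measurableSet_uIoc]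
    filter_upwards [hne1] with x hx1 hx
    rw [Set.uIoc_of_le zero_le_one] at hx
    have h1 := lt_of_le_of_ne hx.2 hx1
    have h2 : (0 : ℝ) < 1 - x := by linarith
    rw [(hasSum_invSqrtCoeff hx.1.le h1).tsum_eq, ← one_div_one_sub_rpow_half h1, sub_self,
      cpow_zero, one_mul, norm_real, Real.norm_of_nonneg (by positivity)]
  · filter_upwards [hne1] with x hx1 hx
    rw [Set.uIoc_of_le zero_le_one] at hx
    have h1 := lt_of_le_of_ne hx.2 hx1
    rw [← one_div_one_sub_rpow_half h1, add_sub_cancel_left]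
    have h := (hasSum_ofReal.mpr (hasSum_invSqrtCoeff hx.1.le h1)).mul_left ((x : ℂ) ^ (I * t))
    refine h.congr_fun ?_
    intro n
    have hx0 : (x : ℂ) ≠ 0 := ofReal_ne_zero.mpr hx.1.ne'
    rw [cpow_add _ _ hx0, cpow_natCast]
    push_cast
    ring

theorem re_betaIntegral_half_le (t : ℝ) : (betaIntegral (1 + I * t) (1 / 2)).re ≤ 2 := by
  have h0 := hasSum_re (hasSum_betaIntegral_half 0)
  have ht := hasSum_re (hasSum_betaIntegral_half t)
  have hval : (betaIntegral (1 + I * (0 : ℝ)) (1 / 2)).re = 2 := by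
    rw [ofReal_zero, mul_zero, add_zero, betaIntegral_symm, betaIntegral_eval_one_right (by norm_num)]
    norm_num
  rw [← hval]
  refine hasSum_le (fun n ↦ ?_) ht h0
  have ha := invSqrtCoeff_nonneg n
  have hn : (0 : ℝ) ≤ n := n.cast_nonneg
  simp [div_re, normSq_apply]
  gcongr
  nlinarith [mul_self_nonneg t]

theorem le_neg_mul_im_betaIntegral_half (t : ℝ) :
    35 / 16 * (t ^ 2 / (16 + t ^ 2)) ≤ -(t * (betaIntegral (1 + I * t) (1 / 2)).im) := by
  have ht := ((hasSum_im (hasSum_betaIntegral_half t)).mul_left t).neg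
  have hterm (n : ℕ) : -(t * ((invSqrtCoeff n : ℂ) / (n + 1 + I * t)).im) =
      invSqrtCoeff n * (t ^ 2 / ((n + 1) ^ 2 + t ^ 2)) := by
    simp [div_im, normSq_apply]
    ring
  simp_rw [hterm] at ht
  refine le_trans ?_ (sum_le_hasSum (Finset.range 4) (fun n _ ↦ ?_) ht)
  · rw [← sum_range_four_invSqrtCoeff, Finset.sum_mul]
    refine Finset.sum_le_sum fun n hn ↦ mul_le_mul_of_nonneg_left ?_ (invSqrtCoeff_nonneg n)
    have hn : (n : ℝ) + 1 ≤ 4 := by exact_mod_cast Finset.mem_range.mp hn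
    gcongr
    nlinarith [(n.cast_nonneg : (0 : ℝ) ≤ n)]
  · have := invSqrtCoeff_nonneg n
    positivity

/-- There exists `c > 0` such that for every real `t` with `|t| > c`,
`Re ((Γ(it)/Γ(3/2 + it)) · (it/(1 + it))) < 0`. -/
theorem exists_c_re_gamma_ratio_neg :
    ∃ c : ℝ, 0 < c ∧ ∀ t : ℝ, c < |t| →
      (Complex.Gamma (Complex.I * t) / Complex.Gamma (3 / 2 + Complex.I * t) *
        (Complex.I * t / (1 + Complex.I * t))).re < 0 := by
  refine ⟨14, by norm_num, fun t ht ↦ ?_⟩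
  have ht2 : 14 ^ 2 < t ^ 2 := by
    rw [← sq_abs t]
    gcongr
  have ht0 : I * (t : ℂ) ≠ 0 := by
    refine mul_ne_zero I_ne_zero (ofReal_ne_zero.mpr ?_)
    rintro rfl
    norm_num at ht2
  have hB := betaIntegral_eq_Gamma_mul_div (1 + I * t) (1 / 2) (by simp) (by norm_num)
  rw [Gamma_one_half_eq, add_comm 1 (I * (t : ℂ)), Gamma_add_one _ ht0,
    show I * (t : ℂ) + 1 + 1 / 2 = 3 / 2 + I * t by ring, add_comm (I * (t : ℂ)) 1,
    show (Real.pi : ℂ) ^ (1 / 2 : ℂ) = (Real.sqrt Real.pi : ℝ) by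
      rw [Real.sqrt_eq_rpow, ofReal_cpow Real.pi_pos.le]; norm_num] at hB
  set B := betaIntegral (1 + I * t) (1 / 2) with hBdef
  have hpi : 0 < Real.sqrt Real.pi := Real.sqrt_pos.mpr Real.pi_pos
  have hpi' : ((Real.sqrt Real.pi : ℝ) : ℂ) ≠ 0 := ofReal_ne_zero.mpr hpi.ne'
  have hd : 0 < 1 + t ^ 2 := by positivity
  have hd1 : (1 : ℂ) + I * t ≠ 0 := fun h ↦ by simpa using congrArg re h
  have hd' : ((Real.sqrt Real.pi * (1 + t ^ 2) : ℝ) : ℂ) ≠ 0 :=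
    ofReal_ne_zero.mpr (by positivity)
  have key : Gamma (I * t) / Gamma (3 / 2 + I * t) * (I * t / (1 + I * t)) =
      B * (1 - I * t) / ((Real.sqrt Real.pi * (1 + t ^ 2) : ℝ) : ℂ) := by
    have h1 : (((Real.sqrt Real.pi * (1 + t ^ 2) : ℝ)) : ℂ) =
        (Real.sqrt Real.pi : ℝ) * ((1 + I * t) * (1 - I * t)) := by
      push_cast
      linear_combination ((Real.sqrt Real.pi : ℝ) : ℂ) * (t : ℂ) ^ 2 * I_sq
    have hd2 : (1 : ℂ) - I * t ≠ 0 := fun h ↦ by simpa using congrArg re h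
    rw [h1, hB]
    field_simp
  rw [key, div_ofReal_re]
  refine div_neg_of_neg_of_pos ?_ (by positivity)
  have hre := re_betaIntegral_half_le t
  have him := le_neg_mul_im_betaIntegral_half t
  rw [← hBdef] at hre him
  have hgt : 2 < 35 / 16 * (t ^ 2 / (16 + t ^ 2)) := by
    rw [← mul_div_assoc, lt_div_iff₀ (by positivity)]
    linarith
  simp [mul_re]
  linarith
end

section
/- There exists a constant C > 0 such that for all X ≥ 3, | (4/X)·∫₀^{arccosh(X/2)} sinh(r)·(1 − 1/cosh r)^{1/2} dr − 2 | ≤ C·(log X)/X. In particular, (4/X)·∫₀^{arccosh(X/2)} sinh(r)·(1 − 1/cosh r)^{1/2} dr → 2 as X → ∞. -/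
open MeasureTheory Filter

/-- The inverse hyperbolic cosine: for `x ≥ 1`, `arccosh x = log (x + √(x² − 1))`,
the unique `r ≥ 0` with `cosh r = x`. -/
noncomputable def arccosh (x : ℝ) : ℝ := Real.log (x + Real.sqrt (x ^ 2 - 1))

theorem arccosh_half_le_log {X : ℝ} (hX : 2 ≤ X) : arccosh (X / 2) ≤ Real.log X := by
  have hs : Real.sqrt ((X / 2) ^ 2 - 1) ≤ X / 2 :=
    Real.sqrt_le_iff.2 ⟨by linarith, by linarith⟩
  have h0 := Real.sqrt_nonneg ((X / 2) ^ 2 - 1)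
  exact Real.log_le_log (by linarith) (by linarith)

theorem sinh_mul_sqrt_le_sinh {r : ℝ} (hr : 0 ≤ r) :
    Real.sinh r * Real.sqrt (1 - 1 / Real.cosh r) ≤ Real.sinh r := by
  have hc : 0 ≤ 1 / Real.cosh r := by have := Real.cosh_pos r; positivity
  exact mul_le_of_le_one_right (Real.sinh_nonneg_iff.2 hr) (Real.sqrt_le_one.2 (by linarith))

theorem sinh_sub_one_le_sinh_mul_sqrt {r : ℝ} (hr : 0 ≤ r) :
    Real.sinh r - 1 ≤ Real.sinh r * Real.sqrt (1 - 1 / Real.cosh r) := by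
  have hc := Real.cosh_pos r
  have hs := Real.sinh_nonneg_iff.2 hr
  have h1 : 1 / Real.cosh r ≤ 1 := (div_le_one hc).2 (Real.one_le_cosh r)
  have h0 : 0 ≤ 1 / Real.cosh r := by positivity
  have hsqrt : 1 - 1 / Real.cosh r ≤ Real.sqrt (1 - 1 / Real.cosh r) :=
    Real.le_sqrt_of_sq_le (by nlinarith)
  have ht : Real.sinh r / Real.cosh r ≤ 1 := (div_le_one hc).2 (Real.sinh_lt_cosh r).le
  calc Real.sinh r - 1 ≤ Real.sinh r - Real.sinh r / Real.cosh r := by linarith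
    _ = Real.sinh r * (1 - 1 / Real.cosh r) := by ring
    _ ≤ _ := mul_le_mul_of_nonneg_left hsqrt hs

theorem continuous_sinh_mul_sqrt :
    Continuous fun r : ℝ => Real.sinh r * Real.sqrt (1 - 1 / Real.cosh r) :=
  Real.continuous_sinh.mul
    (continuous_const.sub
      (continuous_const.div Real.continuous_cosh fun r => (Real.cosh_pos r).ne')).sqrt

theorem integral_sinh_eq_cosh_sub_one (a : ℝ) :
    ∫ r in (0 : ℝ)..a, Real.sinh r = Real.cosh a - 1 := by
  rw [intervalIntegral.integral_eq_sub_of_hasDerivAt (fun r _ => Real.hasDerivAt_cosh r)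
    (Real.continuous_sinh.intervalIntegrable _ _), Real.cosh_zero]

theorem integral_sinh_mul_sqrt_mem_Icc {a : ℝ} (ha : 0 ≤ a) :
    (∫ r in (0 : ℝ)..a, Real.sinh r * Real.sqrt (1 - 1 / Real.cosh r)) ∈
      Set.Icc (Real.cosh a - 1 - a) (Real.cosh a - 1) := by
  have hf := continuous_sinh_mul_sqrt.intervalIntegrable (μ := volume) 0 a
  have hs := Real.continuous_sinh.intervalIntegrable (μ := volume) 0 a
  constructor
  · have h := intervalIntegral.integral_mono_on ha (hs.sub intervalIntegrable_const) hf
      fun r hr => sinh_sub_one_le_sinh_mul_sqrt hr.1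
    rw [intervalIntegral.integral_sub hs intervalIntegrable_const,
      integral_sinh_eq_cosh_sub_one] at h
    simpa using h
  · have h := intervalIntegral.integral_mono_on ha hf hs fun r hr => sinh_mul_sqrt_le_sinh hr.1
    rwa [integral_sinh_eq_cosh_sub_one] at h

theorem abs_integral_sinh_sqrt_sub_two_le {X : ℝ} (hX : 3 ≤ X) :
    |(4 / X) * (∫ r in (0 : ℝ)..arccosh (X / 2),
        Real.sinh r * Real.sqrt (1 - 1 / Real.cosh r)) - 2| ≤ 8 * Real.log X / X := by
  have hX0 : 0 < X := by linarith
  have hX1 : 1 ≤ X / 2 := by linarith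
  have hmem := integral_sinh_mul_sqrt_mem_Icc (a := arccosh (X / 2)) (Real.arcosh_nonneg hX1)
  rw [show Real.cosh (arccosh (X / 2)) = X / 2 from Real.cosh_arcosh hX1] at hmem
  obtain ⟨hl, hu⟩ := hmem
  have hA := arccosh_half_le_log (X := X) (by linarith)
  have hlog : 1 ≤ Real.log X :=
    (Real.le_log_iff_exp_le hX0).2 (Real.exp_one_lt_three.le.trans hX)
  generalize (∫ r in (0 : ℝ)..arccosh (X / 2),
    Real.sinh r * Real.sqrt (1 - 1 / Real.cosh r)) = I at hl hu ⊢
  rw [show 4 / X * I - 2 = (4 * I - 2 * X) / X by field_simp, abs_div, abs_of_pos hX0]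
  gcongr
  exact abs_le.2 ⟨by linarith, by linarith⟩

theorem tendsto_log_div_self_atTop : Tendsto (fun X : ℝ => Real.log X / X) atTop (nhds 0) :=
  Real.isLittleO_log_id_atTop.tendsto_div_nhds_zero

/-- There is `C > 0` with
`|(4/X)·∫₀^{arccosh(X/2)} sinh r · (1 − 1/cosh r)^{1/2} dr − 2| ≤ C·(log X)/X` for all `X ≥ 3`;
in particular the quantity tends to `2` as `X → ∞`. -/
theorem integral_sinh_sqrt_asymptotic :
    ∃ C : ℝ, 0 < C ∧
      (∀ X : ℝ, 3 ≤ X →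
        |(4 / X) * (∫ r in (0 : ℝ)..arccosh (X / 2),
            Real.sinh r * Real.sqrt (1 - 1 / Real.cosh r)) - 2| ≤ C * Real.log X / X) ∧
      Tendsto (fun X : ℝ => (4 / X) * ∫ r in (0 : ℝ)..arccosh (X / 2),
          Real.sinh r * Real.sqrt (1 - 1 / Real.cosh r)) atTop (nhds 2) := by
  refine ⟨8, by norm_num, fun X hX => abs_integral_sinh_sqrt_sub_two_le hX, ?_⟩
  have hlim : Tendsto (fun X : ℝ => 8 * Real.log X / X) atTop (nhds 0) := by
    simpa [mul_div_assoc] using tendsto_log_div_self_atTop.const_mul 8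
  rw [tendsto_iff_norm_sub_tendsto_zero]
  refine squeeze_zero' (Eventually.of_forall fun _ => norm_nonneg _) ?_ hlim
  filter_upwards [eventually_ge_atTop 3] with X hX
  exact abs_integral_sinh_sqrt_sub_two_le hX
end
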